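/- Strong subadditivity of von Neumann entropy (Lieb–Ruskai). Let ρ be a density matrix on ℂ^a ⊗ ℂ^b ⊗ ℂ^c (indexed by triples), with marginals ρ_AB = tr_C ρ, ρ_BC = tr_A ρ, and ρ_B = tr_{AC} ρ. Then S(ρ_AB) + S(ρ_BC) − S(ρ_B) − S(ρ) ≥ 0. -/

import Mathlib

noncomputable section
open Matrix
open scoped Classical ComplexOrder

/-- von Neumann entropy `S(ρ) = −Σᵢ λᵢ log λᵢ` (junk value `0` on non-Hermitian input). -/
def vN {n : Type*} [Fintype n] [DecidableEq n] (ρ : Matrix n n ℂ) : ℝ :=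
  if h : ρ.IsHermitian then -∑ i, (h.eigenvalues i) * Real.log (h.eigenvalues i) else 0

/-- partial trace over the third factor `C`: `ρ_AB`. -/
def ptC {A B C : Type*} [Fintype C] (M : Matrix (A × B × C) (A × B × C) ℂ) :
    Matrix (A × B) (A × B) ℂ :=
  Matrix.of fun p q => ∑ c, M (p.1, p.2, c) (q.1, q.2, c)

/-- partial trace over the first factor `A`: `ρ_BC`. -/
def ptA {A B C : Type*} [Fintype A] (M : Matrix (A × B × C) (A × B × C) ℂ) :
    Matrix (B × C) (B × C) ℂ :=
  Matrix.of fun p q => ∑ a, M (a, p) (a, q)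

/-- partial trace over the first and third factors `A`, `C`: `ρ_B`. -/
def ptAC {A B C : Type*} [Fintype A] [Fintype C] (M : Matrix (A × B × C) (A × B × C) ℂ) :
    Matrix B B ℂ :=
  Matrix.of fun b b' => ∑ a, ∑ c, M (a, b, c) (a, b', c)

open scoped Kronecker

/-! ### Comparing logarithmic sums through their rational derivatives -/

lemma hasDerivAt_mul_log_add {m p q t : ℝ} (h : m ≠ 0 → 0 < p ∧ 0 < q) (ht : 0 ≤ t) :
    HasDerivAt (fun t : ℝ => m * Real.log (q + t * p)) (m * p / (q + t * p)) t := by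
  by_cases hm : m = 0
  · simpa [hm] using hasDerivAt_const t (0 : ℝ)
  · obtain ⟨hp, hq⟩ := h hm
    have hd : q + t * p ≠ 0 := by positivity
    have h1 : HasDerivAt (fun t : ℝ => q + t * p) p t := by
      simpa using ((hasDerivAt_id t).mul_const p).const_add q
    simpa [mul_div_assoc] using (h1.log hd).const_mul m

lemma tendsto_mul_log_add_sub {m p q : ℝ} (h : m ≠ 0 → 0 < p ∧ 0 < q) :
    Filter.Tendsto (fun t : ℝ => m * Real.log (q + t * p) - m * Real.log t) Filter.atTop
      (nhds (m * Real.log p)) := by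
  by_cases hm : m = 0
  · simp [hm]
  · obtain ⟨hp, hq⟩ := h hm
    have h1 : Filter.Tendsto (fun t : ℝ => q * t⁻¹ + p) Filter.atTop (nhds p) := by
      simpa using (tendsto_inv_atTop_zero.const_mul q).add_const p
    refine ((h1.log hp.ne').const_mul m).congr' ?_
    filter_upwards [Filter.eventually_gt_atTop 0] with t ht
    rw [← mul_sub, ← Real.log_div (by positivity) ht.ne']
    congr 2
    field_simp

lemma sum_mul_log_sub_log_le {ι κ : Type*} [Fintype ι] [Fintype κ]
    (m p q : ι → ℝ) (m' p' q' : κ → ℝ)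
    (h : ∀ i, m i ≠ 0 → 0 < p i ∧ 0 < q i) (h' : ∀ i, m' i ≠ 0 → 0 < p' i ∧ 0 < q' i)
    (hmass : ∑ i, m i = ∑ i, m' i)
    (hle : ∀ t : ℝ, 0 < t →
      ∑ i, m i * p i / (q i + t * p i) ≤ ∑ i, m' i * p' i / (q' i + t * p' i)) :
    ∑ i, m i * (Real.log (p i) - Real.log (q i)) ≤
      ∑ i, m' i * (Real.log (p' i) - Real.log (q' i)) := by
  set g : ℝ → ℝ := fun t => ∑ i, m' i * Real.log (q' i + t * p' i) -
    ∑ i, m i * Real.log (q i + t * p i) with hg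
  have hderiv : ∀ t : ℝ, 0 ≤ t → HasDerivAt g
      (∑ i, m' i * p' i / (q' i + t * p' i) - ∑ i, m i * p i / (q i + t * p i)) t := by
    intro t ht
    exact (HasDerivAt.fun_sum fun i _ => hasDerivAt_mul_log_add (h' i) ht).sub
      (HasDerivAt.fun_sum fun i _ => hasDerivAt_mul_log_add (h i) ht)
  have hmono : MonotoneOn g (Set.Ici 0) := by
    refine monotoneOn_of_deriv_nonneg (convex_Ici 0)
      (fun t ht => (hderiv t ht).continuousAt.continuousWithinAt) ?_ ?_
    · intro t ht
      rw [interior_Ici] at ht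
      exact (hderiv t (le_of_lt ht)).differentiableAt.differentiableWithinAt
    · intro t ht
      rw [interior_Ici] at ht
      rw [(hderiv t (le_of_lt ht)).deriv]
      exact sub_nonneg.2 (hle t ht)
  have hlim : Filter.Tendsto g Filter.atTop
      (nhds (∑ i, m' i * Real.log (p' i) - ∑ i, m i * Real.log (p i))) := by
    refine ((tendsto_finsetSum _ fun i _ => tendsto_mul_log_add_sub (h' i)).sub
      (tendsto_finsetSum _ fun i _ => tendsto_mul_log_add_sub (h i))).congr fun t => ?_
    simp only [hg, Finset.sum_sub_distrib, ← Finset.sum_mul, hmass]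
    ring
  have h0 : g 0 ≤ ∑ i, m' i * Real.log (p' i) - ∑ i, m i * Real.log (p i) :=
    ge_of_tendsto hlim ((Filter.eventually_ge_atTop 0).mono fun t ht =>
      hmono Set.self_mem_Ici ht ht)
  simp only [hg, zero_mul, add_zero] at h0
  simp only [mul_sub, Finset.sum_sub_distrib]
  linarith

lemma sum_sum_mul_log_sub_log_le {ι κ : Type*} [Fintype ι] [Fintype κ]
    (m : ι → ι → ℝ) (p q : ι → ℝ) (m' : κ → κ → ℝ) (p' q' : κ → ℝ)
    (h : ∀ i j, m i j ≠ 0 → 0 < p i ∧ 0 < q j) (h' : ∀ i j, m' i j ≠ 0 → 0 < p' i ∧ 0 < q' j)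
    (hmass : ∑ i, ∑ j, m i j = ∑ i, ∑ j, m' i j)
    (hle : ∀ t : ℝ, 0 < t → ∑ i, ∑ j, m i j * p i / (q j + t * p i) ≤
      ∑ i, ∑ j, m' i j * p' i / (q' j + t * p' i)) :
    ∑ i, ∑ j, m i j * (Real.log (p i) - Real.log (q j)) ≤
      ∑ i, ∑ j, m' i j * (Real.log (p' i) - Real.log (q' j)) := by
  simpa only [Fintype.sum_prod_type] using sum_mul_log_sub_log_le
    (fun x : ι × ι => m x.1 x.2) (fun x => p x.1) (fun x => q x.2)
    (fun x : κ × κ => m' x.1 x.2) (fun x => p' x.1) (fun x => q' x.2)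
    (fun x => h x.1 x.2) (fun x => h' x.1 x.2)
    (by simpa only [Fintype.sum_prod_type] using hmass)
    (by simpa only [Fintype.sum_prod_type] using hle)

/-! ### A variational formula -/

/-- The concave quadratic functional whose supremum over `X` is
`⟨ρ^{1/2}, (Δ + t)⁻¹ ρ^{1/2}⟩`, with `Δ` the relative modular operator of `σ` and `ρ`. -/
def modularQuad {n : Type*} [Fintype n] (t : ℝ) (ρ σ X : Matrix n n ℂ) : ℝ :=
  2 * (ρ * X).trace.re - (σ * (X * Xᴴ)).trace.re - t * (ρ * (Xᴴ * X)).trace.re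

lemma re_trace_diagonal_mul_mul_conjTranspose {n : Type*} [Fintype n] [DecidableEq n]
    (d : n → ℝ) (Y : Matrix n n ℂ) :
    (diagonal (fun i => (d i : ℂ)) * (Y * Yᴴ)).trace.re =
      ∑ i, ∑ j, d i * Complex.normSq (Y i j) := by
  simp only [Matrix.trace, Matrix.diag, Matrix.diagonal_mul]
  rw [Complex.re_sum]
  refine Finset.sum_congr rfl fun i _ => ?_
  rw [Complex.re_ofReal_mul, Matrix.mul_apply, Complex.re_sum, Finset.mul_sum]
  refine Finset.sum_congr rfl fun j _ => ?_
  rw [Matrix.conjTranspose_apply, Complex.star_def, Complex.mul_conj, Complex.ofReal_re]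

section Diagonalized

variable {n : Type*} [Fintype n] [DecidableEq n] {U V : Matrix n n ℂ} {p q : n → ℝ}

lemma modularQuad_diagonalized (hU : Uᴴ * U = 1) (hV : Vᴴ * V = 1) (t : ℝ) (Y : Matrix n n ℂ) :
    modularQuad t (U * diagonal (fun i => (p i : ℂ)) * Uᴴ) (V * diagonal (fun i => (q i : ℂ)) * Vᴴ)
      (V * Y * Uᴴ) =
    ∑ i, ∑ j, (2 * p i * ((Uᴴ * V) i j * Y j i).re - (q j + t * p i) * Complex.normSq (Y j i)) := by
  set P : Matrix n n ℂ := diagonal (fun i => (p i : ℂ)) with hP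
  set Q : Matrix n n ℂ := diagonal (fun i => (q i : ℂ)) with hQ
  have cyc : ∀ (W A B : Matrix n n ℂ), Wᴴ * W = 1 →
      ((W * A * Wᴴ) * (W * B * Wᴴ)).trace = (A * B).trace := by
    intro W A B hW
    calc ((W * A * Wᴴ) * (W * B * Wᴴ)).trace
        = (W * (A * (Wᴴ * W) * B * Wᴴ)).trace := by simp only [Matrix.mul_assoc]
      _ = (A * (Wᴴ * W) * B * Wᴴ * W).trace := Matrix.trace_mul_comm _ _
      _ = (A * (Wᴴ * W) * B * (Wᴴ * W)).trace := by simp only [Matrix.mul_assoc]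
      _ = (A * B).trace := by simp [hW]
  have e1 : ((U * P * Uᴴ) * (V * Y * Uᴴ)).trace = (P * ((Uᴴ * V) * Y)).trace := by
    calc ((U * P * Uᴴ) * (V * Y * Uᴴ)).trace
        = (U * (P * ((Uᴴ * V) * Y) * Uᴴ)).trace := by simp only [Matrix.mul_assoc]
      _ = (P * ((Uᴴ * V) * Y) * Uᴴ * U).trace := Matrix.trace_mul_comm _ _
      _ = (P * ((Uᴴ * V) * Y) * (Uᴴ * U)).trace := by simp only [Matrix.mul_assoc]
      _ = _ := by simp [hU]
  have e2 : (V * Y * Uᴴ) * (V * Y * Uᴴ)ᴴ = V * (Y * Yᴴ) * Vᴴ := by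
    calc (V * Y * Uᴴ) * (V * Y * Uᴴ)ᴴ = V * Y * (Uᴴ * U) * Yᴴ * Vᴴ := by
          simp [Matrix.conjTranspose_mul, Matrix.mul_assoc]
      _ = _ := by simp [hU, Matrix.mul_assoc]
  have e3 : (V * Y * Uᴴ)ᴴ * (V * Y * Uᴴ) = U * (Yᴴ * Y) * Uᴴ := by
    calc (V * Y * Uᴴ)ᴴ * (V * Y * Uᴴ) = U * Yᴴ * (Vᴴ * V) * Y * Uᴴ := by
          simp [Matrix.conjTranspose_mul, Matrix.mul_assoc]
      _ = _ := by simp [hV, Matrix.mul_assoc]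
  have e4 := re_trace_diagonal_mul_mul_conjTranspose p Yᴴ
  rw [conjTranspose_conjTranspose] at e4
  rw [modularQuad, e1, e2, e3, cyc V _ _ hV, cyc U _ _ hU,
    re_trace_diagonal_mul_mul_conjTranspose, e4]
  have e5 : (P * ((Uᴴ * V) * Y)).trace.re = ∑ i, ∑ j, p i * ((Uᴴ * V) i j * Y j i).re := by
    simp only [Matrix.trace, Matrix.diag, hP, Matrix.diagonal_mul]
    rw [Complex.re_sum]
    refine Finset.sum_congr rfl fun i _ => ?_
    rw [Complex.re_ofReal_mul, Matrix.mul_apply, Complex.re_sum, Finset.mul_sum]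
  rw [e5, Finset.sum_comm (f := fun i j => q i * Complex.normSq (Y i j))]
  simp only [Finset.mul_sum, ← Finset.sum_sub_distrib, Matrix.conjTranspose_apply,
    Complex.star_def, Complex.normSq_conj]
  refine Finset.sum_congr rfl fun i _ => Finset.sum_congr rfl fun j _ => ?_
  ring

lemma two_mul_re_sub_le {p d : ℝ} (hd : 0 ≤ d) (hpd : d = 0 → p = 0) (w y : ℂ) :
    2 * p * (w * y).re - d * Complex.normSq y ≤ p * Complex.normSq w * p / d := by
  rcases hd.eq_or_lt with h0 | hpos
  · simp [← h0, hpd h0.symm]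
  · rw [le_div_iff₀ hpos]
    simp only [Complex.normSq_apply, Complex.mul_re]
    nlinarith [sq_nonneg (p * w.re - d * y.re), sq_nonneg (p * w.im + d * y.im)]

lemma modularQuad_le (hU : Uᴴ * U = 1) (hV : Vᴴ * V = 1) (hp : ∀ i, 0 ≤ p i) (hq : ∀ i, 0 ≤ q i)
    {t : ℝ} (ht : 0 < t) (X : Matrix n n ℂ) :
    modularQuad t (U * diagonal (fun i => (p i : ℂ)) * Uᴴ)
      (V * diagonal (fun i => (q i : ℂ)) * Vᴴ) X ≤
    ∑ i, ∑ j, p i * Complex.normSq ((Uᴴ * V) i j) * p i / (q j + t * p i) := by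
  have hX : X = V * (Vᴴ * X * U) * Uᴴ := by
    calc X = (V * Vᴴ) * X * (U * Uᴴ) := by
          rw [mul_eq_one_comm.1 hU, mul_eq_one_comm.1 hV]; simp
      _ = _ := by simp only [Matrix.mul_assoc]
  rw [hX, modularQuad_diagonalized hU hV]
  refine Finset.sum_le_sum fun i _ => Finset.sum_le_sum fun j _ => ?_
  have htp : 0 ≤ t * p i := mul_nonneg ht.le (hp i)
  refine two_mul_re_sub_le (add_nonneg (hq j) htp) (fun h => ?_) _ _
  have : t * p i = 0 := by linarith [hq j]
  exact (mul_eq_zero.1 this).resolve_left ht.ne'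

lemma exists_modularQuad_eq (hU : Uᴴ * U = 1) (hV : Vᴴ * V = 1) (t : ℝ) :
    ∃ X, modularQuad t (U * diagonal (fun i => (p i : ℂ)) * Uᴴ)
      (V * diagonal (fun i => (q i : ℂ)) * Vᴴ) X =
    ∑ i, ∑ j, p i * Complex.normSq ((Uᴴ * V) i j) * p i / (q j + t * p i) := by
  refine ⟨V * (Matrix.of fun j i =>
    ((p i / (q j + t * p i) : ℝ) : ℂ) * star ((Uᴴ * V) i j)) * Uᴴ, ?_⟩
  rw [modularQuad_diagonalized hU hV]
  refine Finset.sum_congr rfl fun i _ => Finset.sum_congr rfl fun j _ => ?_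
  rw [Matrix.of_apply]
  generalize (Uᴴ * V) i j = w
  generalize q j + t * p i = d
  have h1 : (w * (((p i / d : ℝ) : ℂ) * star w)).re = p i / d * Complex.normSq w := by
    rw [mul_left_comm, Complex.re_ofReal_mul, Complex.star_def, Complex.mul_conj,
      Complex.ofReal_re]
  rw [h1, Complex.normSq_mul, Complex.normSq_ofReal, Complex.star_def,
    Complex.normSq_conj]
  by_cases hd : d = 0
  · simp [hd]
  · field_simp
    ring

lemma sum_normSq_col (hU : Uᴴ * U = 1) (hV : Vᴴ * V = 1) (i : n) :
    ∑ j, Complex.normSq ((Uᴴ * V) i j) = 1 := by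
  have h : (Uᴴ * V) * (Uᴴ * V)ᴴ = 1 := by
    calc (Uᴴ * V) * (Uᴴ * V)ᴴ = Uᴴ * (V * Vᴴ) * U := by
          simp [Matrix.conjTranspose_mul, Matrix.mul_assoc]
      _ = 1 := by simp [mul_eq_one_comm.1 hV, hU]
  have := congrFun (congrFun h i) i
  rw [Matrix.mul_apply, Matrix.one_apply_eq] at this
  simp only [Matrix.conjTranspose_apply, Complex.star_def, Complex.mul_conj] at this
  exact_mod_cast this

lemma sum_mul_normSq (j : n) :
    ((∑ i, p i * Complex.normSq ((Uᴴ * V) i j) : ℝ) : ℂ) =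
      (Vᴴ * (U * diagonal (fun i => (p i : ℂ)) * Uᴴ) * V) j j := by
  have : Vᴴ * (U * diagonal (fun i => (p i : ℂ)) * Uᴴ) * V =
      (Uᴴ * V)ᴴ * (diagonal (fun i => (p i : ℂ)) * (Uᴴ * V)) := by
    simp [Matrix.conjTranspose_mul, Matrix.mul_assoc]
  rw [this, Matrix.mul_apply, Complex.ofReal_sum]
  refine Finset.sum_congr rfl fun i _ => ?_
  rw [Matrix.diagonal_mul, Matrix.conjTranspose_apply, Complex.ofReal_mul,
    Complex.normSq_eq_conj_mul_self, Complex.star_def]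
  ring

end Diagonalized

/-! ### Partial traces -/

/-- The partial trace over the first of two factors. -/
def ptFst {A N : Type*} [Fintype A] (M : Matrix (A × N) (A × N) ℂ) : Matrix N N ℂ :=
  Matrix.of fun p q => ∑ a, M (a, p) (a, q)

lemma posSemidef_ptFst {A N : Type*} [Fintype A] [Fintype N] {M : Matrix (A × N) (A × N) ℂ}
    (hM : M.PosSemidef) : (ptFst M).PosSemidef := by
  have : ptFst M = ∑ a, M.submatrix (fun x => (a, x)) (fun x => (a, x)) := by
    ext i j
    simp [ptFst, Matrix.sum_apply]
  rw [this]
  exact posSemidef_sum _ fun a _ => hM.submatrix _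

lemma posSemidef_ptC {A B C : Type*} [Fintype A] [Fintype B] [Fintype C]
    {M : Matrix (A × B × C) (A × B × C) ℂ} (hM : M.PosSemidef) : (ptC M).PosSemidef := by
  have : ptC M = ∑ c, M.submatrix (fun x : A × B => (x.1, x.2, c)) (fun x => (x.1, x.2, c)) := by
    ext i j
    simp [ptC, Matrix.sum_apply]
  rw [this]
  exact posSemidef_sum _ fun a _ => hM.submatrix _

lemma trace_ptC {A B C : Type*} [Fintype A] [Fintype B] [Fintype C]
    (M : Matrix (A × B × C) (A × B × C) ℂ) : (ptC M).trace = M.trace := by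
  simp [Matrix.trace, ptC, Fintype.sum_prod_type]

/-- The operator `X ⊗ 1` on the triple product. -/
def extendC {A B : Type*} (C : Type*) [DecidableEq C] (X : Matrix (A × B) (A × B) ℂ) :
    Matrix (A × B × C) (A × B × C) ℂ :=
  (X ⊗ₖ (1 : Matrix C C ℂ)).submatrix (Equiv.prodAssoc A B C).symm (Equiv.prodAssoc A B C).symm

lemma extendC_conjTranspose {A B C : Type*} [DecidableEq C] (X : Matrix (A × B) (A × B) ℂ) :
    extendC C Xᴴ = (extendC C X)ᴴ := by
  rw [extendC, extendC, Matrix.conjTranspose_submatrix, Matrix.conjTranspose_kronecker,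
    Matrix.conjTranspose_one]

section Extend

variable {A B C : Type*} [Fintype A] [Fintype B] [Fintype C] [DecidableEq C]

lemma extendC_mul (X Y : Matrix (A × B) (A × B) ℂ) :
    extendC C (X * Y) = extendC C X * extendC C Y := by
  rw [extendC, extendC, extendC, Matrix.submatrix_mul_equiv, ← Matrix.mul_kronecker_mul, one_mul]

lemma trace_ptC_mul (M : Matrix (A × B × C) (A × B × C) ℂ) (X : Matrix (A × B) (A × B) ℂ) :
    (ptC M * X).trace = (M * extendC C X).trace := by
  simp only [Matrix.trace, Matrix.diag, Matrix.mul_apply, ptC, extendC, Matrix.of_apply,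
    Fintype.sum_prod_type, Matrix.submatrix_apply, Equiv.prodAssoc_symm_apply,
    Matrix.kroneckerMap_apply, Matrix.one_apply, mul_ite, mul_one, mul_zero,
    Finset.sum_ite_eq', Finset.mem_univ, if_true, Finset.sum_mul]
  refine Finset.sum_congr rfl fun a _ => Finset.sum_congr rfl fun b _ => ?_
  rw [Finset.sum_comm (s := (Finset.univ : Finset C))]
  refine Finset.sum_congr rfl fun a' _ => ?_
  rw [Finset.sum_comm]

lemma modularQuad_ptC (t : ℝ) (ρ σ : Matrix (A × B × C) (A × B × C) ℂ)
    (X : Matrix (A × B) (A × B) ℂ) :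
    modularQuad t (ptC ρ) (ptC σ) X = modularQuad t ρ σ (extendC C X) := by
  simp only [modularQuad, trace_ptC_mul, extendC_mul, extendC_conjTranspose]

end Extend

/-! ### Conditional entropy as a relative entropy -/

lemma Matrix.IsHermitian.exists_diagonalization {n : Type*} [Fintype n] [DecidableEq n]
    {M : Matrix n n ℂ} (hM : M.IsHermitian) :
    ∃ U : Matrix n n ℂ, Uᴴ * U = 1 ∧ M = U * diagonal (fun i => (hM.eigenvalues i : ℂ)) * Uᴴ := by
  refine ⟨hM.eigenvectorUnitary, Unitary.coe_star_mul_self hM.eigenvectorUnitary, ?_⟩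
  have h := hM.spectral_theorem
  rw [Unitary.conjStarAlgAut_apply] at h
  exact h

/-- `ρ` and `1 ⊗ tr_A ρ` diagonalized, together with the properties of the joint weights
`p_x |⟨x, y⟩|²` in the two eigenbases. -/
lemma exists_weights_ptFst {A N : Type*} [Fintype A] [Fintype N] [DecidableEq A] [DecidableEq N]
    {ρ : Matrix (A × N) (A × N) ℂ} (hρ : ρ.PosSemidef) :
    ∃ (U V : Matrix (A × N) (A × N) ℂ) (p q : A × N → ℝ), Uᴴ * U = 1 ∧ Vᴴ * V = 1 ∧
      (∀ i, 0 ≤ p i) ∧ (∀ i, 0 ≤ q i) ∧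
      ρ = U * diagonal (fun i => (p i : ℂ)) * Uᴴ ∧
      (1 : Matrix A A ℂ) ⊗ₖ ptFst ρ = V * diagonal (fun i => (q i : ℂ)) * Vᴴ ∧
      (∀ i j, p i * Complex.normSq ((Uᴴ * V) i j) ≠ 0 → 0 < p i ∧ 0 < q j) ∧
      ∑ i, ∑ j, p i * Complex.normSq ((Uᴴ * V) i j) = ρ.trace.re ∧
      ∑ i, ∑ j, p i * Complex.normSq ((Uᴴ * V) i j) * (Real.log (p i) - Real.log (q j)) =
        vN (ptFst ρ) - vN ρ := by
  have hτ := posSemidef_ptFst hρ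
  obtain ⟨U, hU, hρU⟩ := hρ.isHermitian.exists_diagonalization
  obtain ⟨W, hW, hτW⟩ := hτ.isHermitian.exists_diagonalization
  set p := hρ.isHermitian.eigenvalues with hp
  set r := hτ.isHermitian.eigenvalues with hr
  set V : Matrix (A × N) (A × N) ℂ := (1 : Matrix A A ℂ) ⊗ₖ W with hVdef
  have hVH : Vᴴ = (1 : Matrix A A ℂ) ⊗ₖ Wᴴ := by
    rw [hVdef, Matrix.conjTranspose_kronecker, Matrix.conjTranspose_one]
  have hV : Vᴴ * V = 1 := by
    rw [hVH, hVdef, ← Matrix.mul_kronecker_mul, hW, one_mul, Matrix.one_kronecker_one]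
  have hp0 : ∀ i, 0 ≤ p i := hρ.eigenvalues_nonneg
  have hr0 : ∀ i, 0 ≤ r i := hτ.eigenvalues_nonneg
  have hmarg : ∀ y, ∑ a, ∑ i, p i * Complex.normSq ((Uᴴ * V) i (a, y)) = r y := by
    intro y
    have h1 : ((∑ a, ∑ i, p i * Complex.normSq ((Uᴴ * V) i (a, y)) : ℝ) : ℂ) =
        (Wᴴ * ptFst ρ * W) y y := by
      rw [Complex.ofReal_sum]
      simp only [sum_mul_normSq, ← hρU, hVH]
      rw [hVdef]
      simp only [Matrix.mul_apply, Fintype.sum_prod_type, Matrix.kroneckerMap_apply,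
        Matrix.one_apply, ite_mul, mul_ite, one_mul, zero_mul, mul_zero,
        Finset.sum_ite_irrel, Finset.sum_const_zero, Finset.sum_ite_eq, Finset.sum_ite_eq',
        Finset.mem_univ, if_true, ptFst, Matrix.of_apply, Finset.sum_mul, Finset.mul_sum]
      rw [Finset.sum_comm]
      refine Finset.sum_congr rfl fun x _ => ?_
      rw [Finset.sum_comm]
    have h2 : Wᴴ * ptFst ρ * W = diagonal (fun i => (r i : ℂ)) := by
      conv_lhs => rw [hτW]
      calc Wᴴ * (W * diagonal (fun i => (r i : ℂ)) * Wᴴ) * W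
          = (Wᴴ * W) * diagonal (fun i => (r i : ℂ)) * (Wᴴ * W) := by
            simp only [Matrix.mul_assoc]
        _ = _ := by simp [hW]
    rw [h2, Matrix.diagonal_apply_eq] at h1
    exact_mod_cast h1
  have hm0 : ∀ i j, 0 ≤ p i * Complex.normSq ((Uᴴ * V) i j) := fun i j =>
    mul_nonneg (hp0 i) (Complex.normSq_nonneg _)
  refine ⟨U, V, p, fun x => r x.2, hU, hV, hp0, fun i => hr0 _, hρU, ?_, ?_, ?_, ?_⟩
  · have hD : diagonal (fun x : A × N => (r x.2 : ℂ)) =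
        (1 : Matrix A A ℂ) ⊗ₖ diagonal (fun i => (r i : ℂ)) := by
      rw [← Matrix.diagonal_one, Matrix.diagonal_kronecker_diagonal]
      simp
    rw [hD, hVH, hVdef, ← Matrix.mul_kronecker_mul, ← Matrix.mul_kronecker_mul, ← hτW, one_mul,
      one_mul]
  · rintro i ⟨a, y⟩ hm
    refine ⟨(hp0 i).lt_of_ne' (left_ne_zero_of_mul hm), ?_⟩
    refine ((hm0 i (a, y)).lt_of_ne' hm).trans_le ?_
    change _ ≤ r y
    rw [← hmarg y]
    exact (Finset.single_le_sum (f := fun i => p i * Complex.normSq ((Uᴴ * V) i (a, y)))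
      (fun i _ => hm0 i (a, y)) (Finset.mem_univ i)).trans
      (Finset.single_le_sum
        (f := fun a => ∑ i, p i * Complex.normSq ((Uᴴ * V) i (a, y)))
        (fun a _ => Finset.sum_nonneg fun i _ => hm0 i (a, y)) (Finset.mem_univ a))
  · simp only [← Finset.mul_sum, sum_normSq_col hU hV, mul_one]
    rw [hρ.isHermitian.trace_eq_sum_eigenvalues]
    simp [hp]
  · have h1 : ∑ i, ∑ j, p i * Complex.normSq ((Uᴴ * V) i j) * Real.log (p i) = -vN ρ := by
      simp only [← Finset.sum_mul, ← Finset.mul_sum, sum_normSq_col hU hV, mul_one]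
      rw [vN, dif_pos hρ.isHermitian, neg_neg]
    have h2 : ∑ i, ∑ j : A × N, p i * Complex.normSq ((Uᴴ * V) i j) * Real.log (r j.2) =
        -vN (ptFst ρ) := by
      rw [vN, dif_pos hτ.isHermitian, neg_neg, Finset.sum_comm, Fintype.sum_prod_type,
        Finset.sum_comm]
      refine Finset.sum_congr rfl fun y _ => ?_
      simp only [← Finset.sum_mul]
      rw [hmarg y]
    simp only [mul_sub, Finset.sum_sub_distrib]
    rw [h1, h2]
    ring

lemma vN_ptC_sub_le {A B C : Type*} [Fintype A] [Fintype B] [Fintype C]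
    [DecidableEq A] [DecidableEq B] [DecidableEq C]
    {ρ : Matrix (A × B × C) (A × B × C) ℂ} (hρ : ρ.PosSemidef) :
    vN (ptAC ρ) - vN (ptC ρ) ≤ vN (ptA ρ) - vN ρ := by
  obtain ⟨U, V, p, q, hU, hV, hp, hq, hρe, hσe, hsupp, hmass, hent⟩ := exists_weights_ptFst hρ
  obtain ⟨U', V', p', q', hU', hV', -, -, hρe', hσe', hsupp', hmass', hent'⟩ :=
    exists_weights_ptFst (posSemidef_ptC hρ)
  have hσ : ptC ((1 : Matrix A A ℂ) ⊗ₖ ptFst ρ) = (1 : Matrix A A ℂ) ⊗ₖ ptFst (ptC ρ) := by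
    ext x y
    simp only [ptC, ptFst, Matrix.of_apply, Matrix.kroneckerMap_apply, Finset.mul_sum]
    rw [Finset.sum_comm]
  have key := sum_sum_mul_log_sub_log_le (fun i j => p' i * Complex.normSq ((U'ᴴ * V') i j)) p' q'
    (fun i j => p i * Complex.normSq ((Uᴴ * V) i j)) p q hsupp' hsupp ?_ ?_
  · rw [hent, hent'] at key
    exact key
  · rw [hmass, hmass', trace_ptC]
  · intro t ht
    obtain ⟨X, hX⟩ := exists_modularQuad_eq (p := p') (q := q') hU' hV' t
    rw [← hX, ← hρe', ← hσe', ← hσ, modularQuad_ptC, hσe, hρe]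
    exact modularQuad_le hU hV hp hq ht _

/-- **Strong subadditivity of von Neumann entropy (Lieb–Ruskai).**
For a density matrix `ρ` on `ℂ^a ⊗ ℂ^b ⊗ ℂ^c`,
`S(ρ_AB) + S(ρ_BC) − S(ρ_B) − S(ρ) ≥ 0`. -/
theorem strong_subadditivity
    (a b c : ℕ)
    (ρ : Matrix (Fin a × Fin b × Fin c) (Fin a × Fin b × Fin c) ℂ)
    (hρ : ρ.PosSemidef) (hρtr : ρ.trace = 1) :
    0 ≤ vN (ptC ρ) + vN (ptA ρ) - vN (ptAC ρ) - vN ρ := by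
  linarith [vN_ptC_sub_le hρ]
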